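/- Fix positive reals k1,…,k30. In the polynomial ring ℝ[x1,…,x22], the ideal generated by the 22 component polynomials f_1,…,f_22 of the mass action vector field of Net1 equals the ideal generated by the 15 binomials (k2+k3)x13 − k1·x1·x9, (k5+k6)x18 − k4·x2·x10, k3·x13 − k6·x18, (k8+k9)x14 − k7·x2·x3, (k17+k18)x20 − k16·x4·x11, k9·x14 − k18·x20, (k11+k12)x15 − k10·x2·x4, (k14+k15)x19 − k13·x5·x11, k12·x15 − k15·x19, (k20+k21)x16 − k19·x5·x6, (k29+k30)x22 − k28·x7·x12, k21·x16 − k30·x22, (k23+k24)x17 − k22·x5·x7, (k26+k27)x21 − k25·x8·x12, k24·x17 − k27·x21; in particular Net1 has toric steady states for all positive rate constants. -/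

import Mathlib

/-- The `j`-th standard basis vector of `ℕ^22`. -/
def ee (j : Fin 22) : Fin 22 → ℕ := fun i => if i = j then 1 else 0

/-- The 10 motifs `A + B ⇄ C → D + B` of Net1, recorded as tuples `(A, B, C, D)`
(0-based species indices, so `Xⱼ` is index `j - 1`). -/
def motifs1 : Fin 10 → Fin 22 × Fin 22 × Fin 22 × Fin 22 :=
  ![(0, 8, 12, 1),
    (1, 9, 17, 0),
    (2, 1, 13, 3),
    (3, 1, 14, 4),
    (4, 10, 18, 3),
    (3, 10, 19, 2),
    (5, 4, 15, 6),
    (6, 4, 16, 7),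
    (7, 11, 20, 6),
    (6, 11, 21, 5)]

/-- Exponent vector of the source complex of the `i`-th reaction of Net1
(motif `i / 3`; reactions `A+B → C`, `C → A+B`, `C → D+B`). -/
def src1 (i : Fin 30) : Fin 22 → ℕ :=
  let m := motifs1 ⟨i.val / 3, by have := i.isLt; omega⟩
  if i.val % 3 = 0 then ee m.1 + ee m.2.1 else ee m.2.2.1

/-- Exponent vector of the product complex of the `i`-th reaction of Net1. -/
def tgt1 (i : Fin 30) : Fin 22 → ℕ :=
  let m := motifs1 ⟨i.val / 3, by have := i.isLt; omega⟩
  if i.val % 3 = 0 then ee m.2.2.1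
  else if i.val % 3 = 1 then ee m.1 + ee m.2.1
  else ee m.2.2.2 + ee m.2.1

open MvPolynomial

/-- The `j`-th component of the mass action vector field of Net1, as a polynomial in
`ℝ[x₁,…,x22]`. -/
noncomputable def massActionPoly1 (k : Fin 30 → ℝ) (j : Fin 22) :
    MvPolynomial (Fin 22) ℝ :=
  ∑ i : Fin 30,
    C (k i * ((tgt1 i j : ℝ) - (src1 i j : ℝ))) * ∏ l : Fin 22, X l ^ src1 i l


lemma prod_ee (a : Fin 22) :
    ∏ l : Fin 22, (X l : MvPolynomial (Fin 22) ℝ) ^ ee a l = X a := by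
  simp [ee]

/-- Net binding flux of a motif. -/
noncomputable def uu (k : Fin 30 → ℝ) (m : Fin 10) : MvPolynomial (Fin 22) ℝ :=
  C (k ⟨3 * m.val, by omega⟩) * (X (motifs1 m).1 * X (motifs1 m).2.1)
    - C (k ⟨3 * m.val + 1, by omega⟩ + k ⟨3 * m.val + 2, by omega⟩) * X (motifs1 m).2.2.1

/-- Catalytic flux of a motif. -/
noncomputable def vv (k : Fin 30 → ℝ) (m : Fin 10) : MvPolynomial (Fin 22) ℝ :=
  C (k ⟨3 * m.val + 2, by omega⟩) * X (motifs1 m).2.2.1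

lemma sum_thirty (f : Fin 30 → MvPolynomial (Fin 22) ℝ) :
    ∑ i, f i = ∑ m : Fin 10, (f ⟨3 * m.val, by omega⟩ + f ⟨3 * m.val + 1, by omega⟩
      + f ⟨3 * m.val + 2, by omega⟩) := by
  simp only [Fin.sum_univ_succ, Finset.univ_eq_empty, Finset.sum_empty]
  simp only [add_zero, add_assoc]
  rfl

lemma massAction_eq (k : Fin 30 → ℝ) (j : Fin 22) :
    massActionPoly1 k j = ∑ m : Fin 10,
      (uu k m * ((ee (motifs1 m).2.2.1 j : MvPolynomial (Fin 22) ℝ) - (ee (motifs1 m).1 j : MvPolynomial (Fin 22) ℝ)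
          - (ee (motifs1 m).2.1 j : MvPolynomial (Fin 22) ℝ))
        + vv k m * ((ee (motifs1 m).2.2.2 j : MvPolynomial (Fin 22) ℝ) - (ee (motifs1 m).1 j : MvPolynomial (Fin 22) ℝ))) := by
  unfold massActionPoly1
  rw [sum_thirty]
  refine Finset.sum_congr rfl fun m _ => ?_
  have h1 : (3 * m.val + 1) / 3 = m.val := by omega
  have h2 : (3 * m.val + 2) / 3 = m.val := by omega
  have h3 : (3 * m.val + 1) % 3 = 1 := by omega
  have h4 : (3 * m.val + 2) % 3 = 2 := by omega
  have h5 : (3 * m.val) / 3 = m.val := by omega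
  have h6 : (3 * m.val) % 3 = 0 := by omega
  simp only [src1, tgt1, h1, h2, h3, h4, h5, h6, if_true, Fin.eta, one_ne_zero, if_false,
    OfNat.ofNat_ne_zero, OfNat.ofNat_ne_one, Pi.add_apply, pow_add, Finset.prod_mul_distrib,
    prod_ee, uu, vv, map_mul, map_sub, map_add, Nat.cast_add, map_natCast]
  ring

lemma ma_0 (k : Fin 30 → ℝ) : massActionPoly1 k 0 = 0 - uu k 0 - vv k 0 + vv k 1 := by
  rw [massAction_eq]
  simp [Fin.sum_univ_succ, motifs1, ee]
  try ring

lemma ma_1 (k : Fin 30 → ℝ) : massActionPoly1 k 1 = 0 + vv k 0 - uu k 1 - vv k 1 - uu k 2 - uu k 3 := by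
  rw [massAction_eq]
  simp [Fin.sum_univ_succ, motifs1, ee]
  try ring

lemma ma_2 (k : Fin 30 → ℝ) : massActionPoly1 k 2 = 0 - uu k 2 - vv k 2 + vv k 5 := by
  rw [massAction_eq]
  simp [Fin.sum_univ_succ, motifs1, ee]
  try ring

lemma ma_3 (k : Fin 30 → ℝ) : massActionPoly1 k 3 = 0 + vv k 2 - uu k 3 - vv k 3 + vv k 4 - uu k 5 - vv k 5 := by
  rw [massAction_eq]
  simp [Fin.sum_univ_succ, motifs1, ee]
  try ring

lemma ma_4 (k : Fin 30 → ℝ) : massActionPoly1 k 4 = 0 + vv k 3 - uu k 4 - vv k 4 - uu k 6 - uu k 7 := by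
  rw [massAction_eq]
  simp [Fin.sum_univ_succ, motifs1, ee]
  try ring

lemma ma_5 (k : Fin 30 → ℝ) : massActionPoly1 k 5 = 0 - uu k 6 - vv k 6 + vv k 9 := by
  rw [massAction_eq]
  simp [Fin.sum_univ_succ, motifs1, ee]
  try ring

lemma ma_6 (k : Fin 30 → ℝ) : massActionPoly1 k 6 = 0 + vv k 6 - uu k 7 - vv k 7 + vv k 8 - uu k 9 - vv k 9 := by
  rw [massAction_eq]
  simp [Fin.sum_univ_succ, motifs1, ee]
  try ring

lemma ma_7 (k : Fin 30 → ℝ) : massActionPoly1 k 7 = 0 + vv k 7 - uu k 8 - vv k 8 := by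
  rw [massAction_eq]
  simp [Fin.sum_univ_succ, motifs1, ee]
  try ring

lemma ma_8 (k : Fin 30 → ℝ) : massActionPoly1 k 8 = 0 - uu k 0 := by
  rw [massAction_eq]
  simp [Fin.sum_univ_succ, motifs1, ee]
  try ring

lemma ma_9 (k : Fin 30 → ℝ) : massActionPoly1 k 9 = 0 - uu k 1 := by
  rw [massAction_eq]
  simp [Fin.sum_univ_succ, motifs1, ee]
  try ring

lemma ma_10 (k : Fin 30 → ℝ) : massActionPoly1 k 10 = 0 - uu k 4 - uu k 5 := by
  rw [massAction_eq]
  simp [Fin.sum_univ_succ, motifs1, ee]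
  try ring

lemma ma_11 (k : Fin 30 → ℝ) : massActionPoly1 k 11 = 0 - uu k 8 - uu k 9 := by
  rw [massAction_eq]
  simp [Fin.sum_univ_succ, motifs1, ee]
  try ring

lemma ma_12 (k : Fin 30 → ℝ) : massActionPoly1 k 12 = 0 + uu k 0 := by
  rw [massAction_eq]
  simp [Fin.sum_univ_succ, motifs1, ee]
  try ring

lemma ma_13 (k : Fin 30 → ℝ) : massActionPoly1 k 13 = 0 + uu k 2 := by
  rw [massAction_eq]
  simp [Fin.sum_univ_succ, motifs1, ee]
  try ring

lemma ma_14 (k : Fin 30 → ℝ) : massActionPoly1 k 14 = 0 + uu k 3 := by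
  rw [massAction_eq]
  simp [Fin.sum_univ_succ, motifs1, ee]
  try ring

lemma ma_15 (k : Fin 30 → ℝ) : massActionPoly1 k 15 = 0 + uu k 6 := by
  rw [massAction_eq]
  simp [Fin.sum_univ_succ, motifs1, ee]
  try ring

lemma ma_16 (k : Fin 30 → ℝ) : massActionPoly1 k 16 = 0 + uu k 7 := by
  rw [massAction_eq]
  simp [Fin.sum_univ_succ, motifs1, ee]
  try ring

lemma ma_17 (k : Fin 30 → ℝ) : massActionPoly1 k 17 = 0 + uu k 1 := by
  rw [massAction_eq]
  simp [Fin.sum_univ_succ, motifs1, ee]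
  try ring

lemma ma_18 (k : Fin 30 → ℝ) : massActionPoly1 k 18 = 0 + uu k 4 := by
  rw [massAction_eq]
  simp [Fin.sum_univ_succ, motifs1, ee]
  try ring

lemma ma_19 (k : Fin 30 → ℝ) : massActionPoly1 k 19 = 0 + uu k 5 := by
  rw [massAction_eq]
  simp [Fin.sum_univ_succ, motifs1, ee]
  try ring

lemma ma_20 (k : Fin 30 → ℝ) : massActionPoly1 k 20 = 0 + uu k 8 := by
  rw [massAction_eq]
  simp [Fin.sum_univ_succ, motifs1, ee]
  try ring

lemma ma_21 (k : Fin 30 → ℝ) : massActionPoly1 k 21 = 0 + uu k 9 := by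
  rw [massAction_eq]
  simp [Fin.sum_univ_succ, motifs1, ee]
  try ring

set_option maxHeartbeats 4000000 in
/-- For every choice of positive rate constants, the steady state ideal of Net1 (the ideal
generated by the 22 components of the mass action vector field) equals the ideal generated
by the 15 binomials; in particular Net1 has toric steady states.
(Rate constant `kⱼ` of the paper is `k (j-1)` here, species `Xⱼ` is the variable `X (j-1)`.) -/
theorem net1_steady_state_ideal_is_binomial (k : Fin 30 → ℝ) (hk : ∀ i, 0 < k i) :
    Ideal.span (Set.range (massActionPoly1 k)) =
      Ideal.span
       ({C (k 1 + k 2) * X 12 - C (k 0) * (X 0 * X 8),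
        C (k 4 + k 5) * X 17 - C (k 3) * (X 1 * X 9),
        C (k 2) * X 12 - C (k 5) * X 17,
        C (k 7 + k 8) * X 13 - C (k 6) * (X 1 * X 2),
        C (k 16 + k 17) * X 19 - C (k 15) * (X 3 * X 10),
        C (k 8) * X 13 - C (k 17) * X 19,
        C (k 10 + k 11) * X 14 - C (k 9) * (X 1 * X 3),
        C (k 13 + k 14) * X 18 - C (k 12) * (X 4 * X 10),
        C (k 11) * X 14 - C (k 14) * X 18,
        C (k 19 + k 20) * X 15 - C (k 18) * (X 4 * X 5),
        C (k 28 + k 29) * X 21 - C (k 27) * (X 6 * X 11),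
        C (k 20) * X 15 - C (k 29) * X 21,
        C (k 22 + k 23) * X 16 - C (k 21) * (X 4 * X 6),
        C (k 25 + k 26) * X 20 - C (k 24) * (X 7 * X 11),
        C (k 23) * X 16 - C (k 26) * X 20} : Set (MvPolynomial (Fin 22) ℝ)) := by
  apply le_antisymm
  · rw [Ideal.span_le]
    rintro _ ⟨j, rfl⟩
    simp only [SetLike.mem_coe]
    generalize hI : Ideal.span (_ : Set (MvPolynomial (Fin 22) ℝ)) = I
    have u0 : uu k 0 ∈ I := by
      rw [← neg_mem_iff, ← hI]
      apply Ideal.subset_span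
      have : -uu k 0 = C (k 1 + k 2) * X 12 - C (k 0) * (X 0 * X 8) := by
        rw [uu, neg_sub]; rfl
      rw [this]; exact Or.inl rfl
    have u1 : uu k 1 ∈ I := by
      rw [← neg_mem_iff, ← hI]
      apply Ideal.subset_span
      have : -uu k 1 = C (k 4 + k 5) * X 17 - C (k 3) * (X 1 * X 9) := by
        rw [uu, neg_sub]; rfl
      rw [this]; exact Or.inr (Or.inl rfl)
    have u2 : uu k 2 ∈ I := by
      rw [← neg_mem_iff, ← hI]
      apply Ideal.subset_span
      have : -uu k 2 = C (k 7 + k 8) * X 13 - C (k 6) * (X 1 * X 2) := by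
        rw [uu, neg_sub]; exact congrArg₂ _ rfl (congrArg _ (mul_comm _ _))
      rw [this]; exact Or.inr (Or.inr (Or.inr (Or.inl rfl)))
    have u3 : uu k 3 ∈ I := by
      rw [← neg_mem_iff, ← hI]
      apply Ideal.subset_span
      have : -uu k 3 = C (k 10 + k 11) * X 14 - C (k 9) * (X 1 * X 3) := by
        rw [uu, neg_sub]; exact congrArg₂ _ rfl (congrArg _ (mul_comm _ _))
      rw [this]; exact Or.inr (Or.inr (Or.inr (Or.inr (Or.inr (Or.inr (Or.inl rfl))))))
    have u4 : uu k 4 ∈ I := by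
      rw [← neg_mem_iff, ← hI]
      apply Ideal.subset_span
      have : -uu k 4 = C (k 13 + k 14) * X 18 - C (k 12) * (X 4 * X 10) := by
        rw [uu, neg_sub]; rfl
      rw [this]; exact Or.inr (Or.inr (Or.inr (Or.inr (Or.inr (Or.inr (Or.inr (Or.inl rfl)))))))
    have u5 : uu k 5 ∈ I := by
      rw [← neg_mem_iff, ← hI]
      apply Ideal.subset_span
      have : -uu k 5 = C (k 16 + k 17) * X 19 - C (k 15) * (X 3 * X 10) := by
        rw [uu, neg_sub]; rfl
      rw [this]; exact Or.inr (Or.inr (Or.inr (Or.inr (Or.inl rfl))))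
    have u6 : uu k 6 ∈ I := by
      rw [← neg_mem_iff, ← hI]
      apply Ideal.subset_span
      have : -uu k 6 = C (k 19 + k 20) * X 15 - C (k 18) * (X 4 * X 5) := by
        rw [uu, neg_sub]; exact congrArg₂ _ rfl (congrArg _ (mul_comm _ _))
      rw [this]; exact Or.inr (Or.inr (Or.inr (Or.inr (Or.inr (Or.inr (Or.inr (Or.inr (Or.inr (Or.inl rfl)))))))))
    have u7 : uu k 7 ∈ I := by
      rw [← neg_mem_iff, ← hI]
      apply Ideal.subset_span
      have : -uu k 7 = C (k 22 + k 23) * X 16 - C (k 21) * (X 4 * X 6) := by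
        rw [uu, neg_sub]; exact congrArg₂ _ rfl (congrArg _ (mul_comm _ _))
      rw [this]; exact Or.inr (Or.inr (Or.inr (Or.inr (Or.inr (Or.inr (Or.inr (Or.inr (Or.inr (Or.inr (Or.inr (Or.inr (Or.inl rfl))))))))))))
    have u8 : uu k 8 ∈ I := by
      rw [← neg_mem_iff, ← hI]
      apply Ideal.subset_span
      have : -uu k 8 = C (k 25 + k 26) * X 20 - C (k 24) * (X 7 * X 11) := by
        rw [uu, neg_sub]; rfl
      rw [this]; exact Or.inr (Or.inr (Or.inr (Or.inr (Or.inr (Or.inr (Or.inr (Or.inr (Or.inr (Or.inr (Or.inr (Or.inr (Or.inr (Or.inl rfl)))))))))))))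
    have u9 : uu k 9 ∈ I := by
      rw [← neg_mem_iff, ← hI]
      apply Ideal.subset_span
      have : -uu k 9 = C (k 28 + k 29) * X 21 - C (k 27) * (X 6 * X 11) := by
        rw [uu, neg_sub]; rfl
      rw [this]; exact Or.inr (Or.inr (Or.inr (Or.inr (Or.inr (Or.inr (Or.inr (Or.inr (Or.inr (Or.inr (Or.inl rfl))))))))))
    have v0 : vv k 0 - vv k 1 ∈ I := by
      rw [← hI]
      apply Ideal.subset_span
      have : vv k 0 - vv k 1 = C (k 2) * X 12 - C (k 5) * X 17 := rfl
      rw [this]; exact Or.inr (Or.inr (Or.inl rfl))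
    have v2 : vv k 2 - vv k 5 ∈ I := by
      rw [← hI]
      apply Ideal.subset_span
      have : vv k 2 - vv k 5 = C (k 8) * X 13 - C (k 17) * X 19 := rfl
      rw [this]; exact Or.inr (Or.inr (Or.inr (Or.inr (Or.inr (Or.inl rfl)))))
    have v3 : vv k 3 - vv k 4 ∈ I := by
      rw [← hI]
      apply Ideal.subset_span
      have : vv k 3 - vv k 4 = C (k 11) * X 14 - C (k 14) * X 18 := rfl
      rw [this]; exact Or.inr (Or.inr (Or.inr (Or.inr (Or.inr (Or.inr (Or.inr (Or.inr (Or.inl rfl))))))))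
    have v6 : vv k 6 - vv k 9 ∈ I := by
      rw [← hI]
      apply Ideal.subset_span
      have : vv k 6 - vv k 9 = C (k 20) * X 15 - C (k 29) * X 21 := rfl
      rw [this]; exact Or.inr (Or.inr (Or.inr (Or.inr (Or.inr (Or.inr (Or.inr (Or.inr (Or.inr (Or.inr (Or.inr (Or.inl rfl)))))))))))
    have v7 : vv k 7 - vv k 8 ∈ I := by
      rw [← hI]
      apply Ideal.subset_span
      have : vv k 7 - vv k 8 = C (k 23) * X 16 - C (k 26) * X 20 := rfl
      rw [this]; exact Or.inr (Or.inr (Or.inr (Or.inr (Or.inr (Or.inr (Or.inr (Or.inr (Or.inr (Or.inr (Or.inr (Or.inr (Or.inr (Or.inr (rfl))))))))))))))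
    have q : ∀ p, p ∈ I ↔ Ideal.Quotient.mk I p = 0 := fun p => Ideal.Quotient.eq_zero_iff_mem.symm
    simp only [q, map_sub] at *
    fin_cases j
    · change Ideal.Quotient.mk I (massActionPoly1 k 0) = 0
      rw [ma_0]; simp only [map_add, map_sub, map_zero]
      linear_combination - u0 - v0
    · change Ideal.Quotient.mk I (massActionPoly1 k 1) = 0
      rw [ma_1]; simp only [map_add, map_sub, map_zero]
      linear_combination - u1 - u2 - u3 + v0
    · change Ideal.Quotient.mk I (massActionPoly1 k 2) = 0
      rw [ma_2]; simp only [map_add, map_sub, map_zero]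
      linear_combination - u2 - v2
    · change Ideal.Quotient.mk I (massActionPoly1 k 3) = 0
      rw [ma_3]; simp only [map_add, map_sub, map_zero]
      linear_combination - u3 - u5 + v2 - v3
    · change Ideal.Quotient.mk I (massActionPoly1 k 4) = 0
      rw [ma_4]; simp only [map_add, map_sub, map_zero]
      linear_combination - u4 - u6 - u7 + v3
    · change Ideal.Quotient.mk I (massActionPoly1 k 5) = 0
      rw [ma_5]; simp only [map_add, map_sub, map_zero]
      linear_combination - u6 - v6
    · change Ideal.Quotient.mk I (massActionPoly1 k 6) = 0
      rw [ma_6]; simp only [map_add, map_sub, map_zero]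
      linear_combination - u7 - u9 + v6 - v7
    · change Ideal.Quotient.mk I (massActionPoly1 k 7) = 0
      rw [ma_7]; simp only [map_add, map_sub, map_zero]
      linear_combination - u8 + v7
    · change Ideal.Quotient.mk I (massActionPoly1 k 8) = 0
      rw [ma_8]; simp only [map_add, map_sub, map_zero]
      linear_combination - u0
    · change Ideal.Quotient.mk I (massActionPoly1 k 9) = 0
      rw [ma_9]; simp only [map_add, map_sub, map_zero]
      linear_combination - u1
    · change Ideal.Quotient.mk I (massActionPoly1 k 10) = 0
      rw [ma_10]; simp only [map_add, map_sub, map_zero]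
      linear_combination - u4 - u5
    · change Ideal.Quotient.mk I (massActionPoly1 k 11) = 0
      rw [ma_11]; simp only [map_add, map_sub, map_zero]
      linear_combination - u8 - u9
    · change Ideal.Quotient.mk I (massActionPoly1 k 12) = 0
      rw [ma_12]; simp only [map_add, map_sub, map_zero]
      linear_combination u0
    · change Ideal.Quotient.mk I (massActionPoly1 k 13) = 0
      rw [ma_13]; simp only [map_add, map_sub, map_zero]
      linear_combination u2
    · change Ideal.Quotient.mk I (massActionPoly1 k 14) = 0
      rw [ma_14]; simp only [map_add, map_sub, map_zero]
      linear_combination u3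
    · change Ideal.Quotient.mk I (massActionPoly1 k 15) = 0
      rw [ma_15]; simp only [map_add, map_sub, map_zero]
      linear_combination u6
    · change Ideal.Quotient.mk I (massActionPoly1 k 16) = 0
      rw [ma_16]; simp only [map_add, map_sub, map_zero]
      linear_combination u7
    · change Ideal.Quotient.mk I (massActionPoly1 k 17) = 0
      rw [ma_17]; simp only [map_add, map_sub, map_zero]
      linear_combination u1
    · change Ideal.Quotient.mk I (massActionPoly1 k 18) = 0
      rw [ma_18]; simp only [map_add, map_sub, map_zero]
      linear_combination u4
    · change Ideal.Quotient.mk I (massActionPoly1 k 19) = 0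
      rw [ma_19]; simp only [map_add, map_sub, map_zero]
      linear_combination u5
    · change Ideal.Quotient.mk I (massActionPoly1 k 20) = 0
      rw [ma_20]; simp only [map_add, map_sub, map_zero]
      linear_combination u8
    · change Ideal.Quotient.mk I (massActionPoly1 k 21) = 0
      rw [ma_21]; simp only [map_add, map_sub, map_zero]
      linear_combination u9
  · generalize hI : Ideal.span (Set.range (massActionPoly1 k)) = I
    have f : ∀ j, massActionPoly1 k j ∈ I := fun j => by
      rw [← hI]; exact Ideal.subset_span ⟨j, rfl⟩
    have u0 : uu k 0 ∈ I := by
      have := f 12; rwa [ma_12, zero_add] at this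
    have u1 : uu k 1 ∈ I := by
      have := f 17; rwa [ma_17, zero_add] at this
    have u2 : uu k 2 ∈ I := by
      have := f 13; rwa [ma_13, zero_add] at this
    have u3 : uu k 3 ∈ I := by
      have := f 14; rwa [ma_14, zero_add] at this
    have u4 : uu k 4 ∈ I := by
      have := f 18; rwa [ma_18, zero_add] at this
    have u5 : uu k 5 ∈ I := by
      have := f 19; rwa [ma_19, zero_add] at this
    have u6 : uu k 6 ∈ I := by
      have := f 15; rwa [ma_15, zero_add] at this
    have u7 : uu k 7 ∈ I := by
      have := f 16; rwa [ma_16, zero_add] at this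
    have u8 : uu k 8 ∈ I := by
      have := f 20; rwa [ma_20, zero_add] at this
    have u9 : uu k 9 ∈ I := by
      have := f 21; rwa [ma_21, zero_add] at this
    have q : ∀ p, p ∈ I ↔ Ideal.Quotient.mk I p = 0 := fun p => Ideal.Quotient.eq_zero_iff_mem.symm
    simp only [q] at f u0 u1 u2 u3 u4 u5 u6 u7 u8 u9
    have v0 : vv k 0 - vv k 1 ∈ I := by
      rw [q]
      have f0 := f 0
      rw [ma_0] at f0
      simp only [map_add, map_sub, map_zero] at f0 ⊢
      linear_combination -f0 - u0
    have v2 : vv k 2 - vv k 5 ∈ I := by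
      rw [q]
      have f0 := f 2
      rw [ma_2] at f0
      simp only [map_add, map_sub, map_zero] at f0 ⊢
      linear_combination -f0 - u2
    have v3 : vv k 3 - vv k 4 ∈ I := by
      rw [q]
      have f0 := f 4
      rw [ma_4] at f0
      simp only [map_add, map_sub, map_zero] at f0 ⊢
      linear_combination f0 + u6 + u7 + u4
    have v6 : vv k 6 - vv k 9 ∈ I := by
      rw [q]
      have f0 := f 5
      rw [ma_5] at f0
      simp only [map_add, map_sub, map_zero] at f0 ⊢
      linear_combination -f0 - u6
    have v7 : vv k 7 - vv k 8 ∈ I := by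
      rw [q]
      have f0 := f 7
      rw [ma_7] at f0
      simp only [map_add, map_sub, map_zero] at f0 ⊢
      linear_combination f0 + u8
    simp only [← q] at u0 u1 u2 u3 u4 u5 u6 u7 u8 u9
    rw [Ideal.span_le]
    rintro x hx
    simp only [Set.mem_insert_iff, Set.mem_singleton_iff] at hx
    rcases hx with rfl | rfl | rfl | rfl | rfl | rfl | rfl | rfl | rfl | rfl | rfl | rfl | rfl | rfl | rfl
    · have := I.neg_mem u0
      rw [uu, neg_sub] at this
      exact this
    · have := I.neg_mem u1
      rw [uu, neg_sub] at this
      exact this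
    · exact v0
    · have := I.neg_mem u2
      rw [uu, neg_sub, mul_comm (X _) (X _)] at this
      exact this
    · have := I.neg_mem u5
      rw [uu, neg_sub] at this
      exact this
    · exact v2
    · have := I.neg_mem u3
      rw [uu, neg_sub, mul_comm (X _) (X _)] at this
      exact this
    · have := I.neg_mem u4
      rw [uu, neg_sub] at this
      exact this
    · exact v3
    · have := I.neg_mem u6
      rw [uu, neg_sub, mul_comm (X _) (X _)] at this
      exact this
    · have := I.neg_mem u9
      rw [uu, neg_sub] at this
      exact this
    · exact v6
    · have := I.neg_mem u7
      rw [uu, neg_sub, mul_comm (X _) (X _)] at this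
      exact this
    · have := I.neg_mem u8
      rw [uu, neg_sub] at this
      exact this
    · exact v7
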